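/- Let n and k be positive integers with gcd(k, n) = 1, and let f : F_{2^n} → F_{2^n} be the power function f(x) = x^(2^(2k) + 2^k + 1). Then the second-order zero differential uniformity of f is at most 4: for all distinct nonzero a, b ∈ F_{2^n}, the equation f(x+a+b) + f(x+a) + f(x+b) + f(x) = 0 has at most 4 solutions x in F_{2^n}. -/

import Mathlib

/-- If `k` is coprime to `n`, the only fixed points of `x ↦ x ^ 2 ^ k` in the field with `2 ^ n`
elements are `0` and `1`. -/
theorem eq_zero_or_eq_one_of_pow_two_pow_eq_self {F : Type*} [Field F] [Fintype F] {n k : ℕ}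
    (hgcd : Nat.gcd k n = 1) (hcard : Fintype.card F = 2 ^ n) {x : F} (hx : x ^ 2 ^ k = x) :
    x = 0 ∨ x = 1 := by
  refine or_iff_not_imp_left.mpr fun h0 => ?_
  have hn : x ^ (2 ^ n - 1) = 1 := hcard ▸ FiniteField.pow_card_sub_one_eq_one x h0
  have hk : x ^ (2 ^ k - 1) = 1 := by
    apply mul_right_cancel₀ h0
    rw [← pow_succ, Nat.sub_add_cancel Nat.one_le_two_pow, hx, one_mul]
  have h := Nat.dvd_gcd (orderOf_dvd_of_pow_eq_one hk) (orderOf_dvd_of_pow_eq_one hn)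
  rw [Nat.pow_sub_one_gcd_pow_sub_one, hgcd] at h
  exact orderOf_eq_one_iff.mp (Nat.dvd_one.mp (by simpa using h))

/-- In characteristic two, if the ring endomorphism `φ` fixes only `0` and `1`, the vanishing of
the Moore determinant of `1, u, w` forces `w` into the `𝔽₂`-span of `1, u`. -/
theorem mem_span_one_of_moore_eq_zero {F : Type*} [Field F] [CharP F 2] (φ : F →+* F)
    (hφ : ∀ x, φ x = x → x = 0 ∨ x = 1) {u w : F} (hu0 : u ≠ 0) (hu1 : u ≠ 1)
    (h : (φ u + u) * φ (φ w + w) = (φ w + w) * φ (φ u + u)) :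
    w = 0 ∨ w = 1 ∨ w = u ∨ w = 1 + u := by
  have hU : φ u + u ≠ 0 := fun h0 =>
    (hφ u (CharTwo.add_eq_zero.mp h0)).elim hu0 hu1
  have hφU : φ (φ u + u) ≠ 0 := (map_ne_zero φ).mpr hU
  have hfix : φ ((φ w + w) / (φ u + u)) = (φ w + w) / (φ u + u) := by
    rw [map_div₀, div_eq_div_iff hφU hU, mul_comm, h]
  rcases hφ _ hfix with h0 | h1
  · have hw := (div_eq_zero_iff.mp h0).resolve_right hU
    rcases hφ w (CharTwo.add_eq_zero.mp hw) with h | h <;> simp [h]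
  · have hw := (div_eq_one_iff_eq hU).mp h1
    have hwu : φ (w + u) = w + u := by
      rw [map_add]
      linear_combination hw + (φ u - w) * CharTwo.two_eq_zero (R := F)
    rcases hφ _ hwu with h | h
    · exact Or.inr (Or.inr (Or.inl (CharTwo.add_eq_zero.mp h)))
    · exact Or.inr (Or.inr (Or.inr (by
        linear_combination h - u * CharTwo.two_eq_zero (R := F))))

/-- In characteristic two, if the ring endomorphism `φ` fixes only `0` and `1`, the vanishing of
the Moore determinant of `a, b, z` forces `z` into the `𝔽₂`-span of `a, b`. -/
theorem mem_span_of_moore_eq_zero {F : Type*} [Field F] [CharP F 2] (φ : F →+* F)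
    (hφ : ∀ x, φ x = x → x = 0 ∨ x = 1) {a b z : F} (ha : a ≠ 0) (hb : b ≠ 0) (hab : a ≠ b)
    (h : a * (φ b * φ (φ z) + φ z * φ (φ b)) + b * (φ a * φ (φ z) + φ z * φ (φ a)) +
      z * (φ a * φ (φ b) + φ b * φ (φ a)) = 0) :
    z = 0 ∨ z = a ∨ z = b ∨ z = a + b := by
  obtain ⟨u, rfl⟩ : ∃ u, b = a * u := ⟨b / a, by field_simp⟩
  obtain ⟨w, rfl⟩ : ∃ w, z = a * w := ⟨z / a, by field_simp⟩
  have hN : a * φ a * φ (φ a) ≠ 0 := by simp [ha]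
  have key : (φ u + u) * φ (φ w + w) = (φ w + w) * φ (φ u + u) := by
    apply mul_left_cancel₀ hN
    simp only [map_add, map_mul] at h ⊢
    linear_combination h - a * φ a * φ (φ a) *
      (φ w * φ (φ u) + w * φ (φ u) + w * φ u) * CharTwo.two_eq_zero (R := F)
  rcases mem_span_one_of_moore_eq_zero φ hφ (right_ne_zero_of_mul hb)
    (fun h1 => hab (by simp [h1])) key with h | h | h | h <;> simp [h, mul_add]

theorem second_order_zero_differential_uniformity_le_four
    (n k : ℕ) (hn : 0 < n) (hk : 0 < k) (hgcd : Nat.gcd k n = 1)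
    (F : Type*) [Field F] [Fintype F] [DecidableEq F] [CharP F 2]
    (hcard : Fintype.card F = 2 ^ n)
    (f : F → F) (hf : ∀ x, f x = x ^ (2 ^ (2 * k) + 2 ^ k + 1)) :
    ∀ a b : F, a ≠ 0 → b ≠ 0 → a ≠ b →
      (Finset.univ.filter
        (fun x : F => f (x + a + b) + f (x + a) + f (x + b) + f x = 0)).card ≤ 4 := by
  intro a b ha hb hab
  let φ : F →+* F := iterateFrobenius F 2 k
  have hφ_apply : ∀ x, φ x = x ^ 2 ^ k := fun x => iterateFrobenius_def 2 k x
  have hφ : ∀ x, φ x = x → x = 0 ∨ x = 1 := fun x hx =>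
    eq_zero_or_eq_one_of_pow_two_pow_eq_self hgcd hcard (hφ_apply x ▸ hx)
  have hfφ : ∀ x, f x = φ (φ x) * φ x * x := fun x => by
    rw [hf, hφ_apply, hφ_apply, ← pow_mul, ← pow_add, two_mul, pow_succ, pow_add, pow_add, pow_add]
  rcases Finset.eq_empty_or_nonempty (Finset.univ.filter
    (fun x : F => f (x + a + b) + f (x + a) + f (x + b) + f x = 0)) with hS | ⟨y, hy⟩
  · simp [hS]
  refine (Finset.card_le_card (t := {y, y + a, y + b, y + (a + b)}) fun x hx => ?_).trans
    Finset.card_le_four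
  simp only [Finset.mem_filter, Finset.mem_univ, true_and, hfφ, map_add] at hx hy
  have hz := mem_span_of_moore_eq_zero φ hφ (z := x - y) ha hb hab (by
    simp only [map_sub]
    generalize φ (φ x) = x2 at *
    generalize φ (φ y) = y2 at *
    generalize φ (φ a) = a2 at *
    generalize φ (φ b) = b2 at *
    generalize φ x = x1 at *
    generalize φ y = y1 at *
    generalize φ a = a1 at *
    generalize φ b = b1 at *
    have h2 : (2 : F) = 0 := CharTwo.two_eq_zero
    grind)
  rw [sub_eq_zero] at hz
  simpa only [Finset.mem_insert, Finset.mem_singleton, sub_eq_iff_eq_add'] using hz
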